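/- arXiv:2304.08784 — 2 statements merged into one kernel-verified Lean document; each statement's English description precedes it below -/
import Mathlib

section
/- Let V be a real inner product space, let Ξ be a finite nonempty set, let u : Ξ → V, and let W be a subspace of V. Let C ≥ 1 and ε ∈ [0,1). Suppose a : Ξ → V satisfies a(ξ) ∈ W for every ξ ∈ Ξ and the quasi-optimality bound ‖u(ξ) − a(ξ)‖ ≤ C · infDist(u(ξ), W) for every ξ ∈ Ξ (where infDist(v, W) = inf_{w ∈ W} ‖v − w‖). If ξ̂ ∈ Ξ satisfies ‖u(ξ̂) − a(ξ̂)‖² ≥ (1 − ε) · max_{ξ ∈ Ξ} ‖u(ξ) − a(ξ)‖², then infDist(u(ξ̂), W) ≥ (√(1 − ε)/C) · max_{ξ ∈ Ξ} infDist(u(ξ), W). -/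
open Metric

/-- A quasi-maximizer (in relative precision `ε`) of the squared approximation error
`‖u ξ - a ξ‖²`, where `a ξ ∈ W` is a quasi-optimal approximation of `u ξ` in the subspace `W`
with constant `C`, also quasi-maximizes the best-approximation error `infDist (u ξ) W`
with constant `√(1 - ε) / C`. -/
theorem stmt_0 {V : Type*} [NormedAddCommGroup V] [InnerProductSpace ℝ V]
    {Ξ : Type*} [Fintype Ξ] [Nonempty Ξ]
    (u : Ξ → V) (W : Submodule ℝ V) (a : Ξ → V)
    (C : ℝ) (hC : 1 ≤ C) (ε : ℝ) (hε : ε ∈ Set.Ico (0 : ℝ) 1)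
    (ha : ∀ ξ, a ξ ∈ W)
    (hqo : ∀ ξ, ‖u ξ - a ξ‖ ≤ C * infDist (u ξ) (W : Set V))
    (ξhat : Ξ)
    (hsel : ‖u ξhat - a ξhat‖ ^ 2 ≥ (1 - ε) * ⨆ ξ, ‖u ξ - a ξ‖ ^ 2) :
    infDist (u ξhat) (W : Set V) ≥
      (Real.sqrt (1 - ε) / C) * ⨆ ξ, infDist (u ξ) (W : Set V) := by
  have hC0 : 0 < C := by linarith
  have hε1 : 0 ≤ 1 - ε := by linarith [hε.2]
  obtain ⟨η, hη⟩ := exists_eq_ciSup_of_finite (f := fun ξ => infDist (u ξ) (W : Set V))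
  rw [← hη]
  have h1 : infDist (u η) (W : Set V) ≤ ‖u η - a η‖ := by
    rw [← dist_eq_norm]
    exact infDist_le_dist_of_mem (ha η)
  have h2 : ‖u η - a η‖ ^ 2 ≤ ⨆ ξ, ‖u ξ - a ξ‖ ^ 2 :=
    le_ciSup (f := fun ξ => ‖u ξ - a ξ‖ ^ 2) (Set.finite_range _).bddAbove η
  have h3 : Real.sqrt (1 - ε) * ‖u η - a η‖ ≤ ‖u ξhat - a ξhat‖ := by
    refine le_of_abs_le (abs_le_of_sq_le_sq ?_ (norm_nonneg _))
    rw [mul_pow, Real.sq_sqrt hε1]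
    exact (mul_le_mul_of_nonneg_left h2 hε1).trans hsel
  have h4 := mul_le_mul_of_nonneg_left h1 (Real.sqrt_nonneg (1 - ε))
  have h5 := hqo ξhat
  change Real.sqrt (1 - ε) / C * infDist (u η) (W : Set V) ≤ _
  rw [div_mul_eq_mul_div, div_le_iff₀ hC0]
  linarith
end

section
/- Let V be a separable real Hilbert space, let Ξ be a finite nonempty set, and let u : Ξ → V. Let (Ω, F, P) be a probability space with a filtration (F_n)_{n ≥ 0}, and let ξ_n : Ω → Ξ (n ≥ 1) be random variables with ξ_n measurable with respect to F_n. For each n ≥ 0 define the random subspace V_n(ω) = span{u(ξ_1(ω)), …, u(ξ_n(ω))} (with V_0 = {0}), and let u_n(ξ) : Ω → V (for each ξ ∈ Ξ) be F_n-measurable random vectors with u_n(ξ)(ω) ∈ V_n(ω) for all ω (with u_0(ξ) = 0). Let C ≥ 1, ε ∈ (0,1), and let (λ_n)_{n ≥ 1} ⊆ (0,1) with ∑_{n ≥ 1} λ_n = λ < 1. Assume: (i) quasi-optimality: for every n ≥ 0, every ξ ∈ Ξ and every ω ∈ Ω, ‖u(ξ) − u_n(ξ)(ω)‖ ≤ C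 · infDist(u(ξ), V_n(ω)); (ii) PAC selection: for every n ≥ 1, almost surely, the conditional probability given F_{n−1} of the event { ω : ‖u(ξ_n(ω)) − u_{n−1}(ξ_n(ω))(ω)‖² ≥ (1 − ε) · max_{ξ ∈ Ξ} ‖u(ξ) − u_{n−1}(ξ)(ω)‖² } is at least 1 − λ_n. Then P( for all n ≥ 1: infDist(u(ξ_n), V_{n−1}) ≥ (√(1 − ε)/C) · max_{ξ ∈ Ξ} infDist(u(ξ), V_{n−1}) ) ≥ 1 − λ. -/
open MeasureTheory Metric

/-- Theorem 3.1 of the paper: the probabilistic greedy algorithm, in which at each step `n`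
a parameter `ξs n` is selected that is, with conditional probability at least `1 - lam n`
given the past filtration `F (n-1)`, an approximate maximizer in relative precision `ε` of
the squared approximation error `‖u ξ - u_{n-1}(ξ)‖²`, is a weak greedy algorithm with
parameter `√(1-ε)/C` with probability at least `1 - λ`, where `λ = ∑_{n ≥ 1} lam n < 1`
and `C` is the quasi-optimality constant of the approximations `un n ξ ∈ Vn n`. -/
theorem stmt_2 {V : Type*} [NormedAddCommGroup V] [InnerProductSpace ℝ V]
    [CompleteSpace V] [SecondCountableTopology V] [MeasurableSpace V] [BorelSpace V]
    {Ξ : Type*} [Fintype Ξ] [Nonempty Ξ] [MeasurableSpace Ξ]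
    (u : Ξ → V)
    {Ω : Type*} {m0 : MeasurableSpace Ω} (P : Measure Ω) [IsProbabilityMeasure P]
    (F : Filtration ℕ m0)
    -- selected parameters `ξ_n`, `n ≥ 1`, with `ξ_n` measurable w.r.t. `F n`
    (ξs : ℕ → Ω → Ξ)
    (hξmeas : ∀ n, 1 ≤ n → @Measurable Ω Ξ (F n) _ (ξs n))
    -- the random reduced spaces `V_n(ω) = span {u(ξ_1(ω)), …, u(ξ_n(ω))}` (so `V_0 = {0}`)
    (Vn : ℕ → Ω → Submodule ℝ V)
    (hVn : ∀ n ω, Vn n ω = Submodule.span ℝ ((fun i => u (ξs i ω)) '' Set.Icc 1 n))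
    -- the approximations `u_n(ξ) ∈ V_n`, measurable w.r.t. `F n`
    (un : ℕ → Ξ → Ω → V)
    (hunmeas : ∀ n ξ, @Measurable Ω V (F n) _ (un n ξ))
    (hunmem : ∀ n ξ ω, un n ξ ω ∈ Vn n ω)
    (C : ℝ) (hC : 1 ≤ C) (ε : ℝ) (hε : ε ∈ Set.Ioo (0 : ℝ) 1)
    (lam : ℕ → ℝ) (hlam : ∀ n, 1 ≤ n → lam n ∈ Set.Ioo (0 : ℝ) 1)
    (lamtot : ℝ) (hlamsum : HasSum (fun n : ℕ => lam (n + 1)) lamtot)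
    (hlamtot : lamtot < 1)
    -- (i) quasi-optimality of the approximations
    (hqo : ∀ n ξ ω, ‖u ξ - un n ξ ω‖ ≤ C * infDist (u ξ) (Vn n ω : Set V))
    -- (ii) PAC selection: conditionally on `F (n-1)`, with probability at least `1 - lam n`,
    -- `ξ_n` maximizes the squared error up to the relative precision `ε`
    (hPAC : ∀ n, 1 ≤ n → ∀ᵐ ω ∂P,
      1 - lam n ≤
        (P[ Set.indicator {ω' : Ω |
              ‖u (ξs n ω') - un (n - 1) (ξs n ω') ω'‖ ^ 2 ≥
                (1 - ε) * ⨆ ξ, ‖u ξ - un (n - 1) ξ ω'‖ ^ 2}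
              (fun _ => (1 : ℝ)) | F (n - 1)]) ω) :
    (P {ω | ∀ n, 1 ≤ n →
        infDist (u (ξs n ω)) (Vn (n - 1) ω : Set V) ≥
          (Real.sqrt (1 - ε) / C) * ⨆ ξ, infDist (u ξ) (Vn (n - 1) ω : Set V)}).toReal
      ≥ 1 - lamtot := by
  set A : ℕ → Set Ω := fun n => {ω' : Ω |
              ‖u (ξs n ω') - un (n - 1) (ξs n ω') ω'‖ ^ 2 ≥
                (1 - ε) * ⨆ ξ, ‖u ξ - un (n - 1) ξ ω'‖ ^ 2} with hA
  have hC0 : 0 < C := by linarith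
  have h1e : 0 ≤ 1 - ε := by linarith [hε.2]
  -- the deterministic part
  have hdet : ∀ n ω, ω ∈ A n → infDist (u (ξs n ω)) (Vn (n - 1) ω : Set V) ≥
          (Real.sqrt (1 - ε) / C) * ⨆ ξ, infDist (u ξ) (Vn (n - 1) ω : Set V) := by
    intro n ω hω
    have hω' : (1 - ε) * (⨆ ξ, ‖u ξ - un (n - 1) ξ ω‖ ^ 2) ≤
      ‖u (ξs n ω) - un (n - 1) (ξs n ω) ω‖ ^ 2 := hω
    have hs : Real.sqrt (1 - ε) * (⨆ ξ, infDist (u ξ) (Vn (n - 1) ω : Set V)) ≤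
        ‖u (ξs n ω) - un (n - 1) (ξs n ω) ω‖ := by
      rw [Real.mul_iSup_of_nonneg (Real.sqrt_nonneg _)]
      refine ciSup_le fun ξ => ?_
      have h1 : infDist (u ξ) (Vn (n - 1) ω : Set V) ≤ ‖u ξ - un (n - 1) ξ ω‖ := by
        rw [← dist_eq_norm]
        exact infDist_le_dist_of_mem (hunmem (n - 1) ξ ω)
      have h2 : ‖u ξ - un (n - 1) ξ ω‖ ^ 2 ≤ ⨆ ξ, ‖u ξ - un (n - 1) ξ ω‖ ^ 2 :=
        le_ciSup (f := fun ξ => ‖u ξ - un (n - 1) ξ ω‖ ^ 2) (Set.finite_range _).bddAbove ξ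
      have h3 : Real.sqrt (1 - ε) * ‖u ξ - un (n - 1) ξ ω‖ ≤
          ‖u (ξs n ω) - un (n - 1) (ξs n ω) ω‖ := by
        refine le_of_sq_le_sq ?_ (norm_nonneg _)
        rw [mul_pow, Real.sq_sqrt h1e]
        exact (mul_le_mul_of_nonneg_left h2 h1e).trans hω'
      exact (mul_le_mul_of_nonneg_left h1 (Real.sqrt_nonneg _)).trans h3
    have hq := hqo (n - 1) (ξs n ω) ω
    rw [ge_iff_le, div_mul_eq_mul_div, div_le_iff₀ hC0]
    linarith [hs.trans hq]
  -- the events are null measurable and have large probability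
  have hprob : ∀ n, 1 ≤ n → NullMeasurableSet (A n) P ∧ P (A n)ᶜ ≤ ENNReal.ofReal (lam n) := by
    intro n hn
    have hp := hPAC n hn
    have hint : Integrable (Set.indicator (A n) (fun _ => (1 : ℝ))) P := by
      by_contra hni
      have h0 := condExp_of_not_integrable (m := F (n - 1)) hni
      obtain ⟨ω, hω⟩ := hp.exists
      have h0' := congrFun h0 ω
      simp only [Pi.zero_apply] at h0'
      have h2 := (hlam n hn).2
      have h3 : 1 - lam n ≤ 0 := hω.trans_eq h0'
      linarith
    have hnull : NullMeasurableSet (A n) P :=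
      (aemeasurable_indicator_const_iff (1 : ℝ)).1 hint.aemeasurable
    refine ⟨hnull, ?_⟩
    have hge : 1 - lam n ≤ P.real (A n) := by
      have e1 : ∫ ω, (P[Set.indicator (A n) (fun _ => (1 : ℝ)) | F (n - 1)]) ω ∂P
          = ∫ ω, Set.indicator (A n) (fun _ => (1 : ℝ)) ω ∂P := integral_condExp (F.le _)
      have e2 : ∫ ω, Set.indicator (A n) (fun _ => (1 : ℝ)) ω ∂P = P.real (A n) := by
        rw [integral_indicator₀ hnull]; simp
      have e3 : ∫ _ω, (1 - lam n) ∂P ≤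
          ∫ ω, (P[Set.indicator (A n) (fun _ => (1 : ℝ)) | F (n - 1)]) ω ∂P :=
        integral_mono_ae (integrable_const _) integrable_condExp hp
      rw [e1, e2] at e3
      simpa using e3
    have hc : P.real (A n)ᶜ = 1 - P.real (A n) := by
      rw [measureReal_compl₀ hnull]; simp
    rw [← ofReal_measureReal]
    exact ENNReal.ofReal_le_ofReal (by linarith)
  set B : Set Ω := ⋃ n : ℕ, (A (n + 1))ᶜ with hB
  have hBnull : NullMeasurableSet B P :=
    NullMeasurableSet.iUnion fun n => (hprob (n + 1) (by omega)).1.compl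
  have hBle : P B ≤ ENNReal.ofReal lamtot := by
    refine (measure_iUnion_le _).trans ?_
    rw [← hlamsum.tsum_eq, ENNReal.ofReal_tsum_of_nonneg
      (fun n => (hlam (n + 1) (by omega)).1.le) hlamsum.summable]
    exact ENNReal.tsum_le_tsum fun n => (hprob (n + 1) (by omega)).2
  have hl0 : 0 ≤ lamtot := hlamsum.nonneg fun n => (hlam (n + 1) (by omega)).1.le
  have hBr : P.real B ≤ lamtot := ENNReal.toReal_le_of_le_ofReal hl0 hBle
  have hBc : P.real Bᶜ = 1 - P.real B := by
    rw [measureReal_compl₀ hBnull]; simp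
  have hmono : P.real Bᶜ ≤ P.real {ω | ∀ n, 1 ≤ n →
        infDist (u (ξs n ω)) (Vn (n - 1) ω : Set V) ≥
          (Real.sqrt (1 - ε) / C) * ⨆ ξ, infDist (u ξ) (Vn (n - 1) ω : Set V)} := by
    refine measureReal_mono ?_
    intro ω hω n hn
    refine hdet n ω ?_
    by_contra hcon
    refine hω (Set.mem_iUnion.2 ⟨n - 1, ?_⟩)
    rw [Nat.sub_add_cancel hn]
    exact hcon
  rw [measureReal_def P {ω | _}] at hmono
  linarith
end
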